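/- arXiv:math/0607153 — 4 statements merged into one kernel-verified Lean document; each statement's English description precedes it below -/
import Mathlib

section
/- For every z ∈ M₀ and every U ∈ ℝ^{p+q}, the inversion Φ satisfies g_{Φ(z)}(DΦ(z)U, DΦ(z)U) = ‖z‖^{-4(α+1)} g_z(U, U); that is, Φ is a conformal map of (M₀, g) with conformal factor u_Φ(z) = ‖z‖^{2(α+1)}. -/
noncomputable section

open scoped RealInnerProductSpace

/-- Points/tangent vectors of `M = ℝ^p × ℝ^q` with Euclidean norms on the factors. -/
abbrev GVec (p q : ℕ) := EuclideanSpace ℝ (Fin p) × EuclideanSpace ℝ (Fin q)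

/-- The set `M₀ = (ℝ^p \ {0}) × ℝ^q`. -/
def GM0 (p q : ℕ) : Set (GVec p q) := {z | z.1 ≠ 0}

/-- Homogeneous norm `‖(x,y)‖ = (|x|^{2(α+1)} + |y|²)^{1/(2(α+1))}`. -/
def homNorm (α : ℝ) (p q : ℕ) (z : GVec p q) : ℝ :=
  (‖z.1‖ ^ (2 * (α + 1)) + ‖z.2‖ ^ 2) ^ (1 / (2 * (α + 1)))

/-- Anisotropic dilation `δ_t(x,y) = (t x, t^{α+1} y)`. -/
def gdil (α : ℝ) (p q : ℕ) (t : ℝ) (z : GVec p q) : GVec p q :=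
  (t • z.1, (t ^ (α + 1)) • z.2)

/-- Grushin inversion `Φ(z) = δ_{‖z‖^{-2}} z = (x/‖z‖², y/‖z‖^{2(α+1)})`. -/
def ginv (α : ℝ) (p q : ℕ) (z : GVec p q) : GVec p q :=
  ((homNorm α p q z ^ (-(2:ℝ))) • z.1, (homNorm α p q z ^ (-(2 * (α + 1)))) • z.2)

/-- The Riemannian metric `g = (α+1)²|x|^{2α}|dx|² + |dy|²` (depends on the point through `x`). -/
def gMet (α : ℝ) (p q : ℕ) (x : EuclideanSpace ℝ (Fin p)) (U V : GVec p q) : ℝ :=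
  (α + 1) ^ 2 * ‖x‖ ^ (2 * α) * ⟪U.1, V.1⟫ + ⟪U.2, V.2⟫

/-- The Riemannian metric `ĝ = |dx|² + |dy|²/((α+1)²|x|^{2α})`. -/
def ghat (α : ℝ) (p q : ℕ) (x : EuclideanSpace ℝ (Fin p)) (U V : GVec p q) : ℝ :=
  ⟪U.1, V.1⟫ + ⟪U.2, V.2⟫ / ((α + 1) ^ 2 * ‖x‖ ^ (2 * α))

/-- Contraction `Γ(U,V)^k = Γ^k_{ij}U^iV^j` of the Christoffel symbols
`Γ^k_{ij} = α|x|^{-2}(δ_{ik}x_j + δ_{jk}x_i − δ_{ij}x_k)` (x-indices; all other symbols zero). -/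
def gammaMap (α : ℝ) (p q : ℕ) (x : EuclideanSpace ℝ (Fin p)) (U V : GVec p q) : GVec p q :=
  ((α * ‖x‖ ^ (-(2:ℝ))) • (⟪x, V.1⟫ • U.1 + ⟪x, U.1⟫ • V.1 - ⟪U.1, V.1⟫ • x), 0)

/-- Covariant derivative `∇_U V` of a vector field `V` along the constant direction `U`, at `z`. -/
def covDeriv (α : ℝ) (p q : ℕ) (V : GVec p q → GVec p q) (z : GVec p q) (U : GVec p q) :
    GVec p q :=
  fderiv ℝ V z U + gammaMap α p q z.1 U (V z)

/-- Curvature operator `R(X,Y)Z = ∇_X ∇_Y Z − ∇_Y ∇_X Z` on constant (hence commuting) vector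
fields `X, Y, Z`, evaluated at `z`. -/
def curvOp (α : ℝ) (p q : ℕ) (z : GVec p q) (X Y Z : GVec p q) : GVec p q :=
  covDeriv α p q (fun w => gammaMap α p q w.1 Y Z) z X
    - covDeriv α p q (fun w => gammaMap α p q w.1 X Z) z Y

/-- Riemann curvature tensor `R(U,V,X,Y) = g(U, R(X,Y)V)`. -/
def riem (α : ℝ) (p q : ℕ) (z : GVec p q) (U V X Y : GVec p q) : ℝ :=
  gMet α p q z.1 U (curvOp α p q z X Y V)

/-- Ricci tensor `Ric(X,Y) = trace (V ↦ R(V,Y)X)`. -/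
def ricci (α : ℝ) (p q : ℕ) (z : GVec p q) (X Y : GVec p q) : ℝ :=
  (∑ i : Fin p, (curvOp α p q z (EuclideanSpace.single i 1, 0) Y X).1 i)
    + ∑ l : Fin q, (curvOp α p q z (0, EuclideanSpace.single l 1) Y X).2 l

/-- Scalar curvature: the `g`-trace of the Ricci tensor. -/
def scal (α : ℝ) (p q : ℕ) (z : GVec p q) : ℝ :=
  ((α + 1) ^ 2 * ‖z.1‖ ^ (2 * α))⁻¹ *
      (∑ i : Fin p, ricci α p q z (EuclideanSpace.single i 1, 0) (EuclideanSpace.single i 1, 0))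
    + ∑ l : Fin q, ricci α p q z (0, EuclideanSpace.single l 1) (0, EuclideanSpace.single l 1)

/-- The Weyl tensor
`W = R + (1/(n−2)) Ric ⊙ g − (Scal/(2(n−1)(n−2))) g ⊙ g`, where
`(h ⊙ s)(X₁,X₂,X₃,X₄) = h(X₁,X₄)s(X₂,X₃) + h(X₂,X₃)s(X₁,X₄) − h(X₁,X₃)s(X₂,X₄) − h(X₂,X₄)s(X₁,X₃)`
and `n = p + q`. -/
def weyl (α : ℝ) (p q : ℕ) (z : GVec p q) (X₁ X₂ X₃ X₄ : GVec p q) : ℝ :=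
  riem α p q z X₁ X₂ X₃ X₄
    + ((p + q : ℝ) - 2)⁻¹ *
        (ricci α p q z X₁ X₄ * gMet α p q z.1 X₂ X₃ + ricci α p q z X₂ X₃ * gMet α p q z.1 X₁ X₄
          - ricci α p q z X₁ X₃ * gMet α p q z.1 X₂ X₄
          - ricci α p q z X₂ X₄ * gMet α p q z.1 X₁ X₃)
    - scal α p q z / (2 * ((p + q : ℝ) - 1) * ((p + q : ℝ) - 2)) *
        (gMet α p q z.1 X₁ X₄ * gMet α p q z.1 X₂ X₃ + gMet α p q z.1 X₂ X₃ * gMet α p q z.1 X₁ X₄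
          - gMet α p q z.1 X₁ X₃ * gMet α p q z.1 X₂ X₄
          - gMet α p q z.1 X₂ X₄ * gMet α p q z.1 X₁ X₃)

/-- Vertical subspace `T_z S = {(v,0) : ⟨v,x⟩ = 0}`. -/
def TSp (p q : ℕ) (z : GVec p q) : Set (GVec p q) := {U | U.2 = 0 ∧ ⟪U.1, z.1⟫ = 0}

/-- Horizontal subspace `T_z H = {(t x, w) : t ∈ ℝ, w ∈ ℝ^q}`. -/
def THp (p q : ℕ) (z : GVec p q) : Set (GVec p q) := {U | ∃ t : ℝ, U.1 = t • z.1}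

/-- `g`-orthogonal projection of `U` onto the vertical subspace `T_z S`. -/
def projS (p q : ℕ) (z : GVec p q) (U : GVec p q) : GVec p q :=
  (U.1 - (⟪U.1, z.1⟫ / ‖z.1‖ ^ 2) • z.1, 0)

/-- Control (Carnot–Carathéodory) distance of the Grushin vector fields
`X_j = ∂_{x_j}`, `Y_λ = (α+1)|x|^α ∂_{y_λ}`: the infimum of `∫₀ᵀ √(|a|²+|b|²)` over absolutely
continuous admissible paths `γ̇ = Σ aⱼ Xⱼ(γ) + Σ b_λ Y_λ(γ)` joining the two points. -/
def grushinDist (α : ℝ) (p q : ℕ) (z z' : GVec p q) : ℝ :=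
  sInf { L : ℝ |
    ∃ (T : ℝ) (γ : ℝ → GVec p q) (a : ℝ → EuclideanSpace ℝ (Fin p))
      (b : ℝ → EuclideanSpace ℝ (Fin q)),
      0 ≤ T ∧ γ 0 = z ∧ γ T = z' ∧
      (∀ t ∈ Set.Icc (0:ℝ) T,
        γ t = (z.1 + ∫ s in (0:ℝ)..t, a s,
               z.2 + ∫ s in (0:ℝ)..t, ((α + 1) * ‖(γ s).1‖ ^ α) • b s)) ∧
      L = ∫ t in (0:ℝ)..T, Real.sqrt (‖a t‖ ^ 2 + ‖b t‖ ^ 2) }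


/-- The Grushin gauge `|x|^{2(α+1)} + |y|²`, i.e. the homogeneous norm without its root. -/
def grushinGauge (α : ℝ) (p q : ℕ) (z : GVec p q) : ℝ :=
  ‖z.1‖ ^ (2 * (α + 1)) + ‖z.2‖ ^ 2

/-- The differential of the Grushin gauge in the direction `U`. -/
def grushinGaugeDeriv (α : ℝ) (p q : ℕ) (z U : GVec p q) : ℝ :=
  2 * (α + 1) * ‖z.1‖ ^ (2 * α) * ⟪z.1, U.1⟫ + 2 * ⟪z.2, U.2⟫

lemma grushinGauge_nonneg (α : ℝ) (p q : ℕ) (z : GVec p q) : 0 ≤ grushinGauge α p q z := by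
  unfold grushinGauge
  positivity

lemma grushinGauge_pos (α : ℝ) (p q : ℕ) {z : GVec p q} (hz : z ∈ GM0 p q) :
    0 < grushinGauge α p q z := by
  have : 0 < ‖z.1‖ := norm_pos_iff.mpr hz
  unfold grushinGauge
  positivity

lemma homNorm_rpow (α : ℝ) (p q : ℕ) (z : GVec p q) (s : ℝ) :
    homNorm α p q z ^ s = grushinGauge α p q z ^ (1 / (2 * (α + 1)) * s) :=
  (Real.rpow_mul (grushinGauge_nonneg α p q z) _ _).symm

lemma ginv_eq_grushinGauge {α : ℝ} (hα : 0 < α) (p q : ℕ) :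
    ginv α p q = fun z =>
      ((grushinGauge α p q z ^ (-(1 / (α + 1)))) • z.1, (grushinGauge α p q z ^ (-1 : ℝ)) • z.2) := by
  have ha : α + 1 ≠ 0 := by positivity
  funext z
  simp only [ginv, homNorm_rpow]
  congr 3 <;> field_simp

lemma exists_hasFDerivAt_grushinGauge {α : ℝ} (hα : 0 < α) (p q : ℕ) (z : GVec p q) :
    ∃ L : GVec p q →L[ℝ] ℝ, HasFDerivAt (grushinGauge α p q) L z ∧
      ∀ U, L U = grushinGaugeDeriv α p q z U := by
  have hx := (hasFDerivAt_norm_rpow z.1 (p := 2 * (α + 1)) (by linarith)).comp z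
    (hasFDerivAt_fst (𝕜 := ℝ) (p := z))
  have hy := (hasFDerivAt_snd (𝕜 := ℝ) (p := z)).norm_sq
  refine ⟨_, hx.add hy, fun U => ?_⟩
  have he : 2 * (α + 1) - 2 = 2 * α := by ring
  simp [grushinGaugeDeriv, he]

lemma exists_hasFDerivAt_grushinGauge_rpow_smul {α : ℝ} (hα : 0 < α) {p q : ℕ} {z : GVec p q}
    (hz : z ∈ GM0 p q) {E : Type*} [NormedAddCommGroup E] [NormedSpace ℝ E]
    (π : GVec p q →L[ℝ] E) (s : ℝ) :
    ∃ L : GVec p q →L[ℝ] E, HasFDerivAt (fun w => grushinGauge α p q w ^ s • π w) L z ∧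
      ∀ U, L U = grushinGauge α p q z ^ s •
        (π U + (s * grushinGaugeDeriv α p q z U / grushinGauge α p q z) • π z) := by
  obtain ⟨L, hL, hLU⟩ := exists_hasFDerivAt_grushinGauge hα p q z
  have hR := grushinGauge_pos α p q hz
  refine ⟨_, (hL.rpow_const (p := s) (Or.inl hR.ne')).smul π.hasFDerivAt, fun U => ?_⟩
  simp only [add_apply, _root_.smul_apply, ContinuousLinearMap.smulRight_apply, hLU, smul_add,
    smul_smul, smul_eq_mul, Real.rpow_sub_one hR.ne']
  congr 2
  ring

lemma fderiv_ginv_apply {α : ℝ} (hα : 0 < α) {p q : ℕ} {z : GVec p q}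
    (hz : z ∈ GM0 p q) (U : GVec p q) :
    fderiv ℝ (ginv α p q) z U =
      (grushinGauge α p q z ^ (-(1 / (α + 1))) •
        (U.1 + (-(1 / (α + 1)) * grushinGaugeDeriv α p q z U / grushinGauge α p q z) • z.1),
      grushinGauge α p q z ^ (-1 : ℝ) •
        (U.2 + (-1 * grushinGaugeDeriv α p q z U / grushinGauge α p q z) • z.2)) := by
  obtain ⟨L₁, h₁, e₁⟩ := exists_hasFDerivAt_grushinGauge_rpow_smul hα hz
    (ContinuousLinearMap.fst ℝ (EuclideanSpace ℝ (Fin p)) (EuclideanSpace ℝ (Fin q)))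
    (-(1 / (α + 1)))
  obtain ⟨L₂, h₂, e₂⟩ := exists_hasFDerivAt_grushinGauge_rpow_smul hα hz
    (ContinuousLinearMap.snd ℝ (EuclideanSpace ℝ (Fin p)) (EuclideanSpace ℝ (Fin q))) (-1)
  have h : HasFDerivAt (ginv α p q) (L₁.prod L₂) z := by
    rw [ginv_eq_grushinGauge hα]
    exact h₁.prodMk h₂
  rw [h.fderiv]
  exact Prod.ext (e₁ U) (e₂ U)

/-- The cross terms cancel because `R` is the gauge and `D` its differential. -/
lemma inversion_cross_terms_cancel {a X n m R D xu yv uu vv : ℝ} (ha : a ≠ 0) (hR : R ≠ 0)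
    (hRe : R = X * n + m) (hD : D = 2 * a * X * xu + 2 * yv) :
    a ^ 2 * X * (uu + 2 * (-(1 / a) * D / R) * xu + (-(1 / a) * D / R) ^ 2 * n)
      + (vv + 2 * (-1 * D / R) * yv + (-1 * D / R) ^ 2 * m) = a ^ 2 * X * uu + vv := by
  have hyv : yv = D / 2 - a * X * xu := by linarith
  have hm : m = R - X * n := by linarith
  rw [hyv, hm]
  field_simp
  ring

lemma inner_add_smul_self_expand {E : Type*} [NormedAddCommGroup E] [InnerProductSpace ℝ E]
    (c t : ℝ) (u x : E) :
    ⟪c • (u + t • x), c • (u + t • x)⟫ =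
      c ^ 2 * (⟪u, u⟫ + 2 * t * ⟪x, u⟫ + t ^ 2 * ‖x‖ ^ 2) := by
  simp only [inner_smul_left, inner_smul_right, inner_add_left, inner_add_right,
    real_inner_comm x u, real_inner_self_eq_norm_sq x, RCLike.conj_to_real]
  ring

/-- the inversion `Φ = δ_{‖z‖^{-2}}` is conformal for `g` with
conformal factor `‖z‖^{2(α+1)}`. -/
theorem grushin_inversion_conformal_metric
    (α : ℝ) (hα : 0 < α) (p q : ℕ) (hp : 1 ≤ p) (hq : 1 ≤ q)
    (z : GVec p q) (hz : z ∈ GM0 p q) (U : GVec p q) :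
    gMet α p q (ginv α p q z).1 (fderiv ℝ (ginv α p q) z U) (fderiv ℝ (ginv α p q) z U)
      = homNorm α p q z ^ (-(4 * (α + 1))) * gMet α p q z.1 U U := by
  have ha : α + 1 ≠ 0 := by positivity
  have hR := grushinGauge_pos α p q hz
  have hx : 0 < ‖z.1‖ := norm_pos_iff.mpr hz
  have hscale : homNorm α p q z ^ (-(4 * (α + 1))) = grushinGauge α p q z ^ (-2 : ℝ) := by
    rw [homNorm_rpow]
    congr 1
    field_simp
    norm_num
  have hnorm : ‖(ginv α p q z).1‖ ^ (2 * α) * (grushinGauge α p q z ^ (-(1 / (α + 1)))) ^ 2 =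
      grushinGauge α p q z ^ (-2 : ℝ) * ‖z.1‖ ^ (2 * α) := by
    rw [ginv_eq_grushinGauge hα]
    simp only [norm_smul, Real.norm_of_nonneg (Real.rpow_nonneg hR.le _)]
    rw [Real.mul_rpow (by positivity) (by positivity), ← Real.rpow_mul hR.le, mul_right_comm,
      ← Real.rpow_mul_natCast hR.le, ← Real.rpow_add hR]
    congr 2
    push_cast
    field_simp
    ring
  have hsq : (grushinGauge α p q z ^ (-1 : ℝ)) ^ 2 = grushinGauge α p q z ^ (-2 : ℝ) := by
    rw [← Real.rpow_mul_natCast hR.le]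
    norm_num
  have hgauge : grushinGauge α p q z = ‖z.1‖ ^ (2 * α) * ‖z.1‖ ^ 2 + ‖z.2‖ ^ 2 := by
    rw [grushinGauge, mul_add, Real.rpow_add hx, mul_one, Real.rpow_two]
  rw [fderiv_ginv_apply hα hz, hscale]
  simp only [gMet, inner_add_smul_self_expand, hsq]
  rw [← inversion_cross_terms_cancel (uu := ⟪U.1, U.1⟫) (vv := ⟪U.2, U.2⟫) ha hR.ne' hgauge
    (show grushinGaugeDeriv α p q z U = _ from rfl)]
  linear_combination (α + 1) ^ 2 * (⟪U.1, U.1⟫ +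
    2 * (-(1 / (α + 1)) * grushinGaugeDeriv α p q z U / grushinGauge α p q z) * ⟪z.1, U.1⟫ +
    (-(1 / (α + 1)) * grushinGaugeDeriv α p q z U / grushinGauge α p q z) ^ 2 * ‖z.1‖ ^ 2) * hnorm

end
end

section
/- Let y ∈ ℝ^q with y ≠ 0. Then the inversion Φ is differentiable at (0, y) in the x-directions with DΦ(0, y)(v, 0) = |y|^{-2/(α+1)} (v, 0) for every v ∈ ℝ^p; in particular the Euclidean length of the image vector is |y|^{-2/(α+1)} |v| = ‖(0,y)‖^{-2} |v|. -/
noncomputable section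

open scoped RealInnerProductSpace

/-- On the line `t ↦ (t v, y)` the homogeneous norm has vanishing derivative at `t = 0`. -/
lemma hasDerivAt_homNorm_smul_zero {α : ℝ} (hα : 0 < α) {p q : ℕ}
    (v : EuclideanSpace ℝ (Fin p)) {y : EuclideanSpace ℝ (Fin q)} (hy : y ≠ 0) :
    HasDerivAt (fun t : ℝ => homNorm α p q (t • v, y)) 0 0 := by
  have hn : HasDerivAt (fun t : ℝ => ‖t • v‖ ^ (2 * (α + 1))) 0 0 := by
    have hf := hasFDerivAt_norm_rpow ((0 : ℝ) • v) (p := 2 * (α + 1)) (by linarith)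
    simpa [Function.comp_def] using hf.comp_hasDerivAt (0 : ℝ) ((hasDerivAt_id (0 : ℝ)).smul_const v)
  have hne : ‖(0 : ℝ) • v‖ ^ (2 * (α + 1)) + ‖y‖ ^ 2 ≠ 0 := by
    have := norm_pos_iff.mpr hy
    positivity
  simpa [homNorm] using
    (hn.add_const (‖y‖ ^ 2)).rpow_const (p := 1 / (2 * (α + 1))) (Or.inl hne)

lemma homNorm_zero_left {α : ℝ} (hα : 0 < α) {p q : ℕ} (y : EuclideanSpace ℝ (Fin q)) :
    homNorm α p q ((0 : EuclideanSpace ℝ (Fin p)), y) = ‖y‖ ^ (1 / (α + 1)) := by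
  have h : 2 * (α + 1) ≠ 0 := by positivity
  rw [homNorm, norm_zero, Real.zero_rpow h, zero_add, ← Real.rpow_natCast,
    ← Real.rpow_mul (norm_nonneg y)]
  congr 1
  push_cast
  field_simp

/-- at points `(0, y)`, `y ≠ 0`, the inversion is differentiable in the
`x`-directions with `DΦ(0,y)(v,0) = |y|^{-2/(α+1)}(v,0)`, whose Euclidean length is
`|y|^{-2/(α+1)}|v| = ‖(0,y)‖^{-2}|v|`. -/
theorem grushin_inversion_deriv_x_directions
    (α : ℝ) (hα : 0 < α) (p q : ℕ) (hp : 1 ≤ p) (hq : 1 ≤ q)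
    (y : EuclideanSpace ℝ (Fin q)) (hy : y ≠ 0) (v : EuclideanSpace ℝ (Fin p)) :
    HasDerivAt (fun t : ℝ => ginv α p q (t • v, y))
      ((‖y‖ ^ (-(2 / (α + 1)))) • ((v, 0) : GVec p q)) 0
    ∧ ‖y‖ ^ (-(2 / (α + 1))) * ‖v‖
        = homNorm α p q ((0 : EuclideanSpace ℝ (Fin p)), y) ^ (-(2:ℝ)) * ‖v‖ := by
  have hN0 := homNorm_zero_left (p := p) hα y
  have hpow : homNorm α p q ((0 : EuclideanSpace ℝ (Fin p)), y) ^ (-(2 : ℝ))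
      = ‖y‖ ^ (-(2 / (α + 1))) := by
    rw [hN0, ← Real.rpow_mul (norm_nonneg y)]
    congr 1
    ring
  refine ⟨?_, by rw [hpow]⟩
  have hN := hasDerivAt_homNorm_smul_zero hα v hy
  have hne : homNorm α p q ((0 : ℝ) • v, y) ≠ 0 := by
    rw [zero_smul, hN0]
    exact (Real.rpow_pos_of_pos (norm_pos_iff.mpr hy) _).ne'
  have hx := (hN.rpow_const (p := -(2 : ℝ)) (Or.inl hne)).fun_smul
    ((hasDerivAt_id (0 : ℝ)).smul_const v)
  have hy' := (hN.rpow_const (p := -(2 * (α + 1))) (Or.inl hne)).smul_const y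
  refine (hx.prodMk hy').congr_deriv ?_
  rw [zero_smul, hpow]
  simp

end
end

section
/- Let p ≥ 2 and q ≥ 1, and let b ∈ ℝ^q and c > 0. Then the homogeneous sphere Σ = { (x,y) ∈ M₀ : |x|^{2(α+1)} + |y − b|² = c² } is an umbilical hypersurface of (M₀, g) with constant curvature 1/c: there is a choice of unit normal field N along Σ (with respect to g) such that ∇_X N = −(1/c) X for every point P ∈ Σ and every X ∈ T_P Σ. -/
noncomputable section

open scoped RealInnerProductSpace

/-- The inward unit normal field of the homogeneous sphere with centre `(0, b)` and radius `c`. -/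
def sphereNormal (α : ℝ) (p q : ℕ) (b : EuclideanSpace ℝ (Fin q)) (c : ℝ) (z : GVec p q) :
    GVec p q :=
  (-c⁻¹) • ((α + 1)⁻¹ • z.1, z.2 - b)

lemma contDiff_sphereNormal (α : ℝ) (p q : ℕ) (b : EuclideanSpace ℝ (Fin q)) (c : ℝ) :
    ContDiff ℝ (⊤ : ℕ∞) (sphereNormal α p q b c) := by
  unfold sphereNormal
  fun_prop

lemma fderiv_sphereNormal (α : ℝ) (p q : ℕ) (b : EuclideanSpace ℝ (Fin q)) (c : ℝ)
    (z X : GVec p q) :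
    fderiv ℝ (sphereNormal α p q b c) z X = (-c⁻¹) • ((α + 1)⁻¹ • X.1, X.2) := by
  have h : HasFDerivAt (sphereNormal α p q b c) _ z :=
    (((hasFDerivAt_fst (𝕜 := ℝ) (p := z)).fun_const_smul (α + 1)⁻¹).prodMk
      ((hasFDerivAt_snd (𝕜 := ℝ) (p := z)).sub_const b)).fun_const_smul (-c⁻¹)
  rw [h.fderiv]
  simp

lemma norm_rpow_two_mul_add_one {E : Type*} [NormedAddCommGroup E] {x : E} (hx : x ≠ 0)
    (α : ℝ) : ‖x‖ ^ (2 * (α + 1)) = ‖x‖ ^ (2 * α) * ‖x‖ ^ 2 := by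
  rw [mul_add, mul_one, Real.rpow_add (norm_pos_iff.mpr hx), Real.rpow_two]

lemma gMet_sphereNormal_self {α : ℝ} (hα : α + 1 ≠ 0) {p q : ℕ} {b : EuclideanSpace ℝ (Fin q)}
    {c : ℝ} (hc : c ≠ 0) {z : GVec p q} (hz : z.1 ≠ 0)
    (hzc : ‖z.1‖ ^ (2 * (α + 1)) + ‖z.2 - b‖ ^ 2 = c ^ 2) :
    gMet α p q z.1 (sphereNormal α p q b c z) (sphereNormal α p q b c z) = 1 := by
  rw [norm_rpow_two_mul_add_one hz] at hzc
  simp only [gMet, sphereNormal, Prod.smul_fst, Prod.smul_snd, real_inner_smul_left,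
    real_inner_smul_right]
  rw [real_inner_self_eq_norm_sq, real_inner_self_eq_norm_sq]
  generalize ‖z.1‖ ^ (2 * α) = r at hzc ⊢
  field_simp
  linear_combination hzc

lemma hasFDerivAt_sphereFun {α : ℝ} (hα : 0 < α) {p q : ℕ} (b : EuclideanSpace ℝ (Fin q))
    (z : GVec p q) :
    HasFDerivAt (fun w : GVec p q => ‖w.1‖ ^ (2 * (α + 1)) + ‖w.2 - b‖ ^ 2)
      (((2 * (α + 1) * ‖z.1‖ ^ (2 * α)) • innerSL ℝ z.1).comp (ContinuousLinearMap.fst ℝ _ _)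
        + 2 • (innerSL ℝ (z.2 - b)).comp (ContinuousLinearMap.snd ℝ _ _)) z := by
  have h := hasFDerivAt_norm_rpow z.1 (p := 2 * (α + 1)) (by linarith)
  rw [show 2 * (α + 1) - 2 = 2 * α by ring] at h
  exact (h.comp z hasFDerivAt_fst).add
    ((HasFDerivAt.sub_const b (hasFDerivAt_snd (p := z))).norm_sq)

lemma gMet_sphereNormal_eq_zero {α : ℝ} (hα : 0 < α) {p q : ℕ} {b : EuclideanSpace ℝ (Fin q)}
    {c : ℝ} {S : Set (GVec p q)}
    (hS : ∀ w ∈ S, ‖w.1‖ ^ (2 * (α + 1)) + ‖w.2 - b‖ ^ 2 = c ^ 2)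
    {z : GVec p q} (hz : z ∈ S) {X : GVec p q} (hX : X ∈ tangentConeAt ℝ S z) :
    gMet α p q z.1 (sphereNormal α p q b c z) X = 0 := by
  have hconst : HasFDerivWithinAt
      (fun w : GVec p q => ‖w.1‖ ^ (2 * (α + 1)) + ‖w.2 - b‖ ^ 2)
      (0 : GVec p q →L[ℝ] ℝ) S z :=
    (hasFDerivWithinAt_const (c ^ 2) z S).congr hS (hS z hz)
  have h := (hasFDerivAt_sphereFun hα b z).hasFDerivWithinAt.unique_on hconst hX
  simp only [add_apply, ContinuousLinearMap.comp_apply, smul_apply, zero_apply,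
    innerSL_apply_apply, ContinuousLinearMap.coe_fst', ContinuousLinearMap.coe_snd', smul_eq_mul,
    nsmul_eq_mul, Nat.cast_ofNat] at h
  have hα' : α + 1 ≠ 0 := by positivity
  simp only [gMet, sphereNormal, Prod.smul_fst, Prod.smul_snd, real_inner_smul_left]
  have h' : (α + 1) ^ 2 * ‖z.1‖ ^ (2 * α) * (-c⁻¹ * ((α + 1)⁻¹ * ⟪z.1, X.1⟫))
      = -c⁻¹ * ((α + 1) * ‖z.1‖ ^ (2 * α) * ⟪z.1, X.1⟫) := by
    field_simp
  rw [h']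
  linear_combination (-c⁻¹ / 2) * h

lemma gammaMap_sphereNormal (α : ℝ) {p q : ℕ} (b : EuclideanSpace ℝ (Fin q)) (c : ℝ)
    {z : GVec p q} (hz : z.1 ≠ 0) (X : GVec p q) :
    gammaMap α p q z.1 X (sphereNormal α p q b c z) = (-c⁻¹) • ((α * (α + 1)⁻¹) • X.1, 0) := by
  have hz' : ‖z.1‖ ≠ 0 := norm_ne_zero_iff.mpr hz
  ext1
  · simp only [gammaMap, sphereNormal, Prod.smul_fst, real_inner_smul_right,
      real_inner_self_eq_norm_sq, real_inner_comm X.1 z.1, Real.rpow_neg (norm_nonneg z.1),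
      Real.rpow_two]
    match_scalars
    · field_simp
    · ring
  · simp [gammaMap]

lemma covDeriv_sphereNormal {α : ℝ} (hα : α + 1 ≠ 0) {p q : ℕ} (b : EuclideanSpace ℝ (Fin q))
    (c : ℝ) {z : GVec p q} (hz : z.1 ≠ 0) (X : GVec p q) :
    covDeriv α p q (sphereNormal α p q b c) z X = (-c⁻¹) • X := by
  rw [covDeriv, fderiv_sphereNormal, gammaMap_sphereNormal α b c hz, ← smul_add]
  congr 1
  ext1
  · simp only [Prod.fst_add, ← add_smul]
    rw [show (α + 1)⁻¹ + α * (α + 1)⁻¹ = 1 by field_simp; ring, one_smul]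
  · simp

/-- homogeneous spheres `|x|^{2(α+1)} + |y−b|² = c²` are umbilical
hypersurfaces of `(M₀, g)` with constant curvature `1/c`: for a suitable unit normal `N`,
`∇_X N = −(1/c) X` on tangent vectors. -/
theorem grushin_sphere_umbilical
    (α : ℝ) (hα : 0 < α) (p q : ℕ) (hp : 2 ≤ p) (hq : 1 ≤ q)
    (b : EuclideanSpace ℝ (Fin q)) (c : ℝ) (hc : 0 < c)
    (S : Set (GVec p q))
    (hSdef : S = {z : GVec p q | z.1 ≠ 0 ∧ ‖z.1‖ ^ (2 * (α + 1)) + ‖z.2 - b‖ ^ 2 = c ^ 2}) :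
    ∃ N : GVec p q → GVec p q,
      ContDiffOn ℝ (⊤ : ℕ∞) N (GM0 p q) ∧
      (∀ P ∈ S, gMet α p q P.1 (N P) (N P) = 1) ∧
      (∀ P ∈ S, ∀ X ∈ tangentConeAt ℝ S P, gMet α p q P.1 (N P) X = 0) ∧
      (∀ P ∈ S, ∀ X ∈ tangentConeAt ℝ S P,
        fderiv ℝ N P X + gammaMap α p q P.1 X (N P) = (-c⁻¹) • X) := by
  have hα' : α + 1 ≠ 0 := by positivity
  subst hSdef
  exact ⟨sphereNormal α p q b c, (contDiff_sphereNormal α p q b c).contDiffOn,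
    fun P hP => gMet_sphereNormal_self hα' hc.ne' hP.1 hP.2,
    fun P hP X hX => gMet_sphereNormal_eq_zero hα (fun w hw => hw.2) hP hX,
    fun P hP X _ => covDeriv_sphereNormal hα' b c hP.1 X⟩

end
end

section
/- Let p ≥ 2 and q ≥ 1. Then: (i) for every a ∈ ℝ^q∖{0} and c ∈ ℝ, the plane Σ = { (x,y) ∈ M₀ : ⟨a, y⟩ = c } is a totally geodesic hypersurface of (M₀, g), i.e. its unit normal field N satisfies ∇_X N = 0 for all tangent vectors X; and (ii) for every a ∈ ℝ^p∖{0}, the plane Σ = { (x,y) ∈ M₀ : ⟨a, x⟩ = 0 } is a totally geodesic hypersurface of (M₀, g). -/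
noncomputable section

open scoped RealInnerProductSpace

theorem ContinuousLinearMap.apply_eq_zero_of_mem_tangentConeAt {E : Type*}
    [NormedAddCommGroup E] [NormedSpace ℝ E] (L : E →L[ℝ] ℝ) {S : Set E} {c : ℝ}
    (hS : ∀ z ∈ S, L z = c) {P : E} (hP : P ∈ S) {X : E} (hX : X ∈ tangentConeAt ℝ S P) :
    L X = 0 := by
  have h : HasFDerivWithinAt L (0 : E →L[ℝ] ℝ) S P :=
    (hasFDerivWithinAt_const c P S).congr hS (hS P hP)
  simpa using L.hasFDerivWithinAt.unique_on h hX

theorem inner_fst_eq_zero_of_mem_tangentConeAt {E F : Type*}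
    [NormedAddCommGroup E] [InnerProductSpace ℝ E] [NormedAddCommGroup F] [NormedSpace ℝ F]
    {a : E} {S : Set (E × F)} {c : ℝ} (hS : ∀ z ∈ S, ⟪a, z.1⟫ = c)
    {P : E × F} (hP : P ∈ S) {X : E × F} (hX : X ∈ tangentConeAt ℝ S P) : ⟪a, X.1⟫ = 0 :=
  ((innerSL ℝ a).comp (ContinuousLinearMap.fst ℝ E F)).apply_eq_zero_of_mem_tangentConeAt hS hP hX

theorem inner_snd_eq_zero_of_mem_tangentConeAt {E F : Type*}
    [NormedAddCommGroup E] [NormedSpace ℝ E] [NormedAddCommGroup F] [InnerProductSpace ℝ F]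
    {a : F} {S : Set (E × F)} {c : ℝ} (hS : ∀ z ∈ S, ⟪a, z.2⟫ = c)
    {P : E × F} (hP : P ∈ S) {X : E × F} (hX : X ∈ tangentConeAt ℝ S P) : ⟪a, X.2⟫ = 0 :=
  ((innerSL ℝ a).comp (ContinuousLinearMap.snd ℝ E F)).apply_eq_zero_of_mem_tangentConeAt hS hP hX

/-- The `g`-unit normal field of the plane `⟨a,x⟩ = 0`. -/
def xPlaneNormal (α : ℝ) (p q : ℕ) (a : EuclideanSpace ℝ (Fin p)) (z : GVec p q) : GVec p q :=
  ((‖z.1‖ ^ 2) ^ (-α / 2)) • (((α + 1) * ‖a‖)⁻¹ • a, 0)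

theorem contDiffOn_xPlaneNormal (α : ℝ) (p q : ℕ) (a : EuclideanSpace ℝ (Fin p)) {n : ℕ∞} :
    ContDiffOn ℝ n (xPlaneNormal α p q a) (GM0 p q) :=
  ((contDiff_fst.contDiffOn.norm_sq ℝ).rpow_const_of_ne fun _ hz ↦
    pow_ne_zero 2 (norm_ne_zero_iff.2 hz)).smul contDiffOn_const

theorem fderiv_xPlaneNormal (α : ℝ) (p q : ℕ) (a : EuclideanSpace ℝ (Fin p)) {z : GVec p q}
    (hz : z.1 ≠ 0) (X : GVec p q) :
    fderiv ℝ (xPlaneNormal α p q a) z X =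
      (-α * ‖z.1‖ ^ (-2 : ℝ) * ⟪z.1, X.1⟫) • xPlaneNormal α p q a z := by
  have hz' : 0 < ‖z.1‖ := norm_pos_iff.2 hz
  have h := (((hasFDerivAt_fst (𝕜 := ℝ) (p := z)).norm_sq.rpow_const (p := -α / 2)
    (Or.inl (pow_ne_zero 2 hz'.ne'))).smul_const
      ((((α + 1) * ‖a‖)⁻¹ • a, 0) : GVec p q))
  have h' : fderiv ℝ (xPlaneNormal α p q a) z = _ := h.fderiv
  have e : (‖z.1‖ ^ 2) ^ (-α / 2 - 1) = (‖z.1‖ ^ 2) ^ (-α / 2) * ‖z.1‖ ^ (-2 : ℝ) := by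
    rw [Real.rpow_sub (by positivity), Real.rpow_one, Real.rpow_neg hz'.le, Real.rpow_two,
      div_eq_mul_inv]
  rw [h', xPlaneNormal, smul_smul]
  simp only [ContinuousLinearMap.smulRight_apply, smul_apply,
    ContinuousLinearMap.comp_apply, ContinuousLinearMap.coe_fst', innerSL_apply_apply,
    smul_eq_mul, nsmul_eq_mul, e]
  congr 1
  push_cast
  ring

theorem gMet_xPlaneNormal_self {α : ℝ} (hα : 0 < α) (p q : ℕ) {a : EuclideanSpace ℝ (Fin p)}
    (ha : a ≠ 0) {z : GVec p q} (hz : z.1 ≠ 0) :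
    gMet α p q z.1 (xPlaneNormal α p q a z) (xPlaneNormal α p q a z) = 1 := by
  have hz' : 0 < ‖z.1‖ := norm_pos_iff.2 hz
  have ha' : 0 < ‖a‖ := norm_pos_iff.2 ha
  have e : (‖z.1‖ ^ 2) ^ (-α / 2) = (‖z.1‖ ^ α)⁻¹ := by
    rw [← Real.rpow_natCast, ← Real.rpow_mul hz'.le, ← Real.rpow_neg hz'.le]
    congr 1
    push_cast
    ring
  have e' : ‖z.1‖ ^ (2 * α) = (‖z.1‖ ^ α) ^ 2 := by
    rw [mul_comm, Real.rpow_mul hz'.le, Real.rpow_two]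
  have hpow : 0 < ‖z.1‖ ^ α := Real.rpow_pos_of_pos hz' α
  simp only [gMet, xPlaneNormal, e, e', Prod.smul_fst, Prod.smul_snd, smul_zero,
    inner_zero_left, real_inner_self_eq_norm_sq, norm_smul, mul_pow, Real.norm_eq_abs, sq_abs]
  field_simp
  ring

/-- (i) planes `⟨a,y⟩ = c` and (ii) planes `⟨a,x⟩ = 0` are totally geodesic
hypersurfaces of `(M₀, g)`: a suitable unit normal `N` satisfies `∇_X N = 0` on tangent
vectors. -/
theorem grushin_planes_totally_geodesic
    (α : ℝ) (hα : 0 < α) (p q : ℕ) (hp : 2 ≤ p) (hq : 1 ≤ q) :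
    (∀ (a : EuclideanSpace ℝ (Fin q)), a ≠ 0 → ∀ c : ℝ, ∀ S : Set (GVec p q),
      S = {z : GVec p q | z.1 ≠ 0 ∧ ⟪a, z.2⟫ = c} →
      ∃ N : GVec p q → GVec p q,
        ContDiffOn ℝ (⊤ : ℕ∞) N (GM0 p q) ∧
        (∀ P ∈ S, gMet α p q P.1 (N P) (N P) = 1) ∧
        (∀ P ∈ S, ∀ X ∈ tangentConeAt ℝ S P, gMet α p q P.1 (N P) X = 0) ∧
        (∀ P ∈ S, ∀ X ∈ tangentConeAt ℝ S P,
          fderiv ℝ N P X + gammaMap α p q P.1 X (N P) = 0))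
    ∧ (∀ (a : EuclideanSpace ℝ (Fin p)), a ≠ 0 → ∀ S : Set (GVec p q),
      S = {z : GVec p q | z.1 ≠ 0 ∧ ⟪a, z.1⟫ = 0} →
      ∃ N : GVec p q → GVec p q,
        ContDiffOn ℝ (⊤ : ℕ∞) N (GM0 p q) ∧
        (∀ P ∈ S, gMet α p q P.1 (N P) (N P) = 1) ∧
        (∀ P ∈ S, ∀ X ∈ tangentConeAt ℝ S P, gMet α p q P.1 (N P) X = 0) ∧
        (∀ P ∈ S, ∀ X ∈ tangentConeAt ℝ S P,
          fderiv ℝ N P X + gammaMap α p q P.1 X (N P) = 0)) := by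
  refine ⟨fun a ha c S hS ↦ ?_, fun a ha S hS ↦ ?_⟩
  · have hS₂ : ∀ z ∈ S, ⟪a, z.2⟫ = c := fun z hz ↦ by rw [hS] at hz; exact hz.2
    refine ⟨fun _ ↦ (0, ‖a‖⁻¹ • a), contDiffOn_const, fun P _ ↦ ?_, fun P hP X hX ↦ ?_,
      fun P _ X _ ↦ ?_⟩
    · have ha' : ‖a‖ ≠ 0 := norm_ne_zero_iff.2 ha
      simp only [gMet, inner_zero_left, real_inner_self_eq_norm_sq, norm_smul, mul_pow,
        Real.norm_eq_abs, sq_abs]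
      field_simp
      ring
    · simp [gMet, real_inner_smul_left, inner_snd_eq_zero_of_mem_tangentConeAt hS₂ hP hX]
    · simp [gammaMap]
  · have hS₀ : ∀ z ∈ S, z.1 ≠ 0 := fun z hz ↦ by rw [hS] at hz; exact hz.1
    have hS₁ : ∀ z ∈ S, ⟪a, z.1⟫ = 0 := fun z hz ↦ by rw [hS] at hz; exact hz.2
    refine ⟨xPlaneNormal α p q a, contDiffOn_xPlaneNormal α p q a,
      fun P hP ↦ gMet_xPlaneNormal_self hα p q ha (hS₀ P hP), fun P hP X hX ↦ ?_,
      fun P hP X hX ↦ ?_⟩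
    · simp [gMet, xPlaneNormal, real_inner_smul_left,
        inner_fst_eq_zero_of_mem_tangentConeAt hS₁ hP hX]
    · have hx : ⟪P.1, a⟫ = 0 := by rw [real_inner_comm, hS₁ P hP]
      have hX' : ⟪X.1, a⟫ = 0 := by
        rw [real_inner_comm, inner_fst_eq_zero_of_mem_tangentConeAt hS₁ hP hX]
      rw [fderiv_xPlaneNormal α p q a (hS₀ P hP)]
      ext1
      · simp only [gammaMap, xPlaneNormal, Prod.fst_add, Prod.smul_fst, Prod.fst_zero,
          real_inner_smul_right, hx, hX']
        module
      · simp [gammaMap, xPlaneNormal]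

end
end
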